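/- Let D ≥ 3 and γ ∈ (−1,1). For a bilinear map α : m × m → m which is rotation equivariant and galilean-boost equivariant, define (writing X = (h,p), Y = (h',p'), Z = (h'',p'') and q := h p' − h' p ∈ ℝ^D) the torsion Θ(X,Y) := α(X,Y) − α(Y,X) − (0, (1+γ) q) and the curvature Ω(X,Y)Z := α(X,α(Y,Z)) − α(Y,α(X,Z)) − α((0,(1+γ)q), Z) − (0, γ h'' q); these are the torsion and curvature of the invariant connection with Nomizu map α on torsional galilean de Sitter spacetime dSG_γ (brackets [H,B_a] = −P_a, [H,P_a] = γ B_a + (1+γ) P_a). Then Θ ≡ 0 and Ω ≡ 0 if and only if α((h,p),(h',p')) = ((γ−1)hh', γ h p' − h' p) or α((h,p),(h',p')) = ((1−γ)hh', h p' − γ h' p); that is, dSG_γ admits precisely two torsion-free, flat invariant connections. -/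

import Mathlib

open Matrix

/-- The vector space `m = ℝ × ℝ^D`, with elements written `(h, p)`;
`H = (1, 0)` and `P a = (0, e a)`. -/
abbrev Mspace (D : ℕ) : Type := ℝ × (Fin D → ℝ)

/-- The infinitesimal rotation `ρ_Λ (h, p) = (0, Λ p)` associated to a `D × D` matrix `Λ`. -/
noncomputable def rotMap {D : ℕ} (Λ : Matrix (Fin D) (Fin D) ℝ) :
    Mspace D →ₗ[ℝ] Mspace D :=
  LinearMap.prod 0 (Λ.mulVecLin ∘ₗ LinearMap.snd ℝ ℝ (Fin D → ℝ))

/-- The galilean boost `β_a (h, p) = (0, h • e_a)`. -/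
noncomputable def galBoost {D : ℕ} (a : Fin D) : Mspace D →ₗ[ℝ] Mspace D :=
  LinearMap.prod 0
    (LinearMap.toSpanSingleton ℝ (Fin D → ℝ) (Pi.single a 1) ∘ₗ
      LinearMap.fst ℝ ℝ (Fin D → ℝ))

/-- A bilinear map `α : m × m → m` is equivariant under a linear endomorphism `X` of `m`
if `X (α Y Z) = α (X Y) Z + α Y (X Z)` for all `Y Z ∈ m`. -/
def IsEquivariant {D : ℕ} (X : Mspace D →ₗ[ℝ] Mspace D)
    (α : Mspace D →ₗ[ℝ] Mspace D →ₗ[ℝ] Mspace D) : Prop :=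
  ∀ Y Z : Mspace D, X (α Y Z) = α (X Y) Z + α Y (X Z)

/-- `q = h p' - h' p` for `X = (h, p)`, `Y = (h', p')`. -/
noncomputable def qvec {D : ℕ} (X Y : Mspace D) : Fin D → ℝ :=
  X.1 • Y.2 - Y.1 • X.2

/-- The torsion of the invariant connection with Nomizu map `α` on torsional galilean
de Sitter spacetime `dSG_γ`: `Θ(X,Y) = α(X,Y) - α(Y,X) - (0, (1+γ) q)`. -/
noncomputable def torsionDSGgamma {D : ℕ} (γ : ℝ)
    (α : Mspace D →ₗ[ℝ] Mspace D →ₗ[ℝ] Mspace D) (X Y : Mspace D) : Mspace D :=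
  α X Y - α Y X - ((0, (1 + γ) • qvec X Y) : Mspace D)

/-- The curvature of the invariant connection with Nomizu map `α` on torsional galilean
de Sitter spacetime `dSG_γ`:
`Ω(X,Y)Z = α(X,α(Y,Z)) - α(Y,α(X,Z)) - α((0, (1+γ) q), Z) - (0, γ h'' q)`. -/
noncomputable def curvatureDSGgamma {D : ℕ} (γ : ℝ)
    (α : Mspace D →ₗ[ℝ] Mspace D →ₗ[ℝ] Mspace D) (X Y Z : Mspace D) : Mspace D :=
  α X (α Y Z) - α Y (α X Z) - α ((0, (1 + γ) • qvec X Y) : Mspace D) Z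
    - ((0, (γ * Z.1) • qvec X Y) : Mspace D)

/-- The infinitesimal rotation in the coordinate plane spanned by `e i` and `e j`. -/
noncomputable def planeRot {D : ℕ} (i j : Fin D) : Matrix (Fin D) (Fin D) ℝ :=
  Matrix.single i j 1 - Matrix.single j i 1

lemma planeRot_transpose {D : ℕ} (i j : Fin D) : (planeRot i j)ᵀ = -planeRot i j := by
  simp [planeRot]

lemma planeRot_mulVec_apply {D : ℕ} {i j : Fin D} (hij : i ≠ j) (u : Fin D → ℝ) :
    (planeRot i j *ᵥ u) i = u j := by
  simp [planeRot, Matrix.sub_mulVec, Matrix.single_mulVec, hij]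

lemma planeRot_mulVec_single {D : ℕ} {i j : Fin D} (hij : i ≠ j) :
    planeRot i j *ᵥ Pi.single j 1 = Pi.single i 1 := by
  ext k
  simp [planeRot, hij, Pi.single_apply, Matrix.single_apply, eq_comm]

lemma rotMap_apply {D : ℕ} (Λ : Matrix (Fin D) (Fin D) ℝ) (v : Mspace D) :
    rotMap Λ v = (0, Λ *ᵥ v.2) := rfl

lemma galBoost_apply {D : ℕ} (a : Fin D) (v : Mspace D) :
    galBoost a v = (0, v.1 • Pi.single a 1) := rfl

section Equivariant

variable {D : ℕ} {α : Mspace D →ₗ[ℝ] Mspace D →ₗ[ℝ] Mspace D}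

/-- Rotation equivariance forces the spatial part of `α H H` to vanish. -/
lemma snd_time_time_eq_zero (hD : 2 ≤ D)
    (hrot : ∀ Λ : Matrix (Fin D) (Fin D) ℝ, Λᵀ = -Λ → IsEquivariant (rotMap Λ) α) :
    (α (1, 0) (1, 0)).2 = 0 := by
  have : Nontrivial (Fin D) := Fin.nontrivial_iff_two_le.mpr hD
  ext j
  obtain ⟨i, hij⟩ := exists_ne j
  have h := hrot _ (planeRot_transpose i j) (1, 0) (1, 0)
  simp only [rotMap_apply, Matrix.mulVec_zero, Prod.mk_zero_zero, map_zero,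
    LinearMap.zero_apply, add_zero, Prod.mk_eq_zero, true_and] at h
  simpa [planeRot_mulVec_apply hij] using congrFun h i

/-- Rotation equivariance forces the time part of `α H P` to vanish. -/
lemma fst_time_space_eq_zero (hD : 2 ≤ D)
    (hrot : ∀ Λ : Matrix (Fin D) (Fin D) ℝ, Λᵀ = -Λ → IsEquivariant (rotMap Λ) α)
    (p : Fin D → ℝ) : (α (1, 0) (0, p)).1 = 0 := by
  have : Nontrivial (Fin D) := Fin.nontrivial_iff_two_le.mpr hD
  suffices hf : LinearMap.fst ℝ ℝ (Fin D → ℝ) ∘ₗ α (1, 0) ∘ₗ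
      LinearMap.inr ℝ ℝ (Fin D → ℝ) = 0 from LinearMap.congr_fun hf p
  refine (Pi.basisFun ℝ (Fin D)).ext fun i => ?_
  obtain ⟨j, hij⟩ := exists_ne i
  have h := hrot _ (planeRot_transpose i j) (1, 0) (0, Pi.single j 1)
  simp only [rotMap_apply, Matrix.mulVec_zero, Prod.mk_zero_zero, map_zero,
    LinearMap.zero_apply, zero_add, planeRot_mulVec_single hij.symm] at h
  simpa using (congrArg Prod.fst h).symm

/-- Boost equivariance in an arbitrary direction `u`. -/
lemma boost_equivariance (hboost : ∀ a : Fin D, IsEquivariant (galBoost a) α)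
    (Y Z : Mspace D) (u : Fin D → ℝ) :
    ((0, (α Y Z).1 • u) : Mspace D) = α (0, Y.1 • u) Z + α Y (0, Z.1 • u) := by
  suffices hf : (α Y Z).1 • LinearMap.inr ℝ ℝ (Fin D → ℝ) =
      Y.1 • (α.flip Z ∘ₗ LinearMap.inr ℝ ℝ (Fin D → ℝ)) +
        Z.1 • (α Y ∘ₗ LinearMap.inr ℝ ℝ (Fin D → ℝ)) by
    have h := LinearMap.congr_fun hf u
    have e (c : ℝ) : ((0, c • u) : Mspace D) = c • (0, u) := by simp
    rw [e, e, e]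
    simpa only [map_smul, LinearMap.smul_apply, LinearMap.add_apply, LinearMap.comp_apply,
      LinearMap.inr_apply, LinearMap.flip_apply] using h
  refine (Pi.basisFun ℝ (Fin D)).ext fun a => ?_
  have h := hboost a Y Z
  have e (c : ℝ) : ((0, c • Pi.single a 1) : Mspace D) = c • (0, Pi.single a 1) := by simp
  simp only [galBoost_apply, e, map_smul, LinearMap.smul_apply] at h
  simpa only [LinearMap.smul_apply, LinearMap.add_apply, LinearMap.comp_apply,
    LinearMap.inr_apply, LinearMap.flip_apply, Pi.basisFun_apply] using h

/-- A torsion-free equivariant Nomizu map on `dSG_γ` is determined by one real parameter. -/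
lemma exists_param_of_torsion_free (hD : 2 ≤ D) {γ : ℝ}
    (hrot : ∀ Λ : Matrix (Fin D) (Fin D) ℝ, Λᵀ = -Λ → IsEquivariant (rotMap Λ) α)
    (hboost : ∀ a : Fin D, IsEquivariant (galBoost a) α)
    (htor : ∀ X Y : Mspace D, torsionDSGgamma γ α X Y = 0) :
    ∃ c : ℝ, ∀ v w : Mspace D,
      α v w = ((2 * c + 1 + γ) * (v.1 * w.1), ((c + 1 + γ) * v.1) • w.2 + (c * w.1) • v.2) := by
  obtain ⟨a, ha⟩ : ∃ a : ℝ, α (1, 0) (1, 0) = (a, 0) :=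
    ⟨_, Prod.ext rfl (snd_time_time_eq_zero hD hrot)⟩
  have hPP (p q : Fin D → ℝ) : α (0, p) (0, q) = 0 := by
    have h := boost_equivariance hboost (1, 0) (0, q) p
    simpa [fst_time_space_eq_zero hD hrot, ← Prod.zero_eq_mk] using h.symm
  have hsum (p : Fin D → ℝ) : α (0, p) (1, 0) + α (1, 0) (0, p) = a • (0, p) := by
    have h := boost_equivariance hboost (1, 0) (1, 0) p
    simpa [ha] using h.symm
  have hdiff (p : Fin D → ℝ) :
      α (1, 0) (0, p) - α (0, p) (1, 0) = (1 + γ) • ((0, p) : Mspace D) := by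
    have h := htor (1, 0) (0, p)
    simpa [torsionDSGgamma, qvec, sub_eq_zero] using h
  have hHP (p : Fin D → ℝ) :
      α (1, 0) (0, p) = ((a + 1 + γ) / 2) • ((0, p) : Mspace D) := by
    linear_combination (norm := module) (1 / 2 : ℝ) • hsum p + (1 / 2 : ℝ) • hdiff p
  have hPH (p : Fin D → ℝ) :
      α (0, p) (1, 0) = ((a - 1 - γ) / 2) • ((0, p) : Mspace D) := by
    linear_combination (norm := module) (1 / 2 : ℝ) • hsum p - (1 / 2 : ℝ) • hdiff p
  refine ⟨(a - 1 - γ) / 2, fun v w => ?_⟩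
  have split (v : Mspace D) : v = v.1 • ((1, 0) : Mspace D) + (0, v.2) := by
    ext <;> simp
  conv_lhs => rw [split v, split w]
  simp only [map_add, map_smul, LinearMap.add_apply, LinearMap.smul_apply, ha, hPP, hHP, hPH]
  ext
  · simp
    ring
  · simp
    ring

end Equivariant


/-- For `D ≥ 3`, `γ ∈ (-1,1)` and a rotation- and galilean-boost-equivariant bilinear
map `α`, the associated invariant connection on `dSG_γ` is torsion-free and flat if and
only if `α((h,p),(h',p')) = ((γ-1)hh', γ h p' - h' p)` or
`α((h,p),(h',p')) = ((1-γ)hh', h p' - γ h' p)`:  `dSG_γ` admits precisely two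
torsion-free, flat invariant connections. -/
theorem dSGgamma_torsion_free_flat_connections (D : ℕ) (hD : 3 ≤ D)
    (γ : ℝ) (hγ₁ : -1 < γ) (hγ₂ : γ < 1)
    (α : Mspace D →ₗ[ℝ] Mspace D →ₗ[ℝ] Mspace D)
    (hrot : ∀ Λ : Matrix (Fin D) (Fin D) ℝ, Λᵀ = -Λ → IsEquivariant (rotMap Λ) α)
    (hboost : ∀ a : Fin D, IsEquivariant (galBoost a) α) :
    ((∀ X Y : Mspace D, torsionDSGgamma γ α X Y = 0) ∧
      (∀ X Y Z : Mspace D, curvatureDSGgamma γ α X Y Z = 0))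
    ↔ ((∀ v w : Mspace D,
          α v w = (((γ - 1) * (v.1 * w.1), (γ * v.1) • w.2 - w.1 • v.2) : Mspace D)) ∨
        (∀ v w : Mspace D,
          α v w = (((1 - γ) * (v.1 * w.1), v.1 • w.2 - (γ * w.1) • v.2) : Mspace D))) := by
  have : Nontrivial (Fin D) := Fin.nontrivial_iff_two_le.mpr (by omega)
  constructor
  · rintro ⟨htor, hcurv⟩
    obtain ⟨c, hc⟩ := exists_param_of_torsion_free (by omega) hrot hboost htor
    obtain ⟨i⟩ : Nonempty (Fin D) := inferInstance
    have h := hcurv (1, 0) (0, Pi.single i 1) (1, 0)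
    simp only [curvatureDSGgamma, qvec, hc] at h
    have hi := congrFun (congrArg Prod.snd h) i
    simp at hi
    have hprod : (c + 1) * (c + γ) = 0 := by linear_combination -hi
    rcases mul_eq_zero.mp hprod with h0 | h0
    · obtain rfl : c = -1 := by linarith
      left
      intro v w
      rw [hc]
      ext
      · dsimp only
        ring
      · simp
        ring
    · obtain rfl : c = -γ := by linarith
      right
      intro v w
      rw [hc]
      ext
      · dsimp only
        ring
      · simp
        ring
  · rintro (h | h) <;> constructor
    all_goals
      intros
      simp only [torsionDSGgamma, curvatureDSGgamma, qvec, h]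
      ext
      · simp
        try ring
      · simp
        try ring
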